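/- Let b = (b¹,…,b^d) : ℝ^d × ℝ → ℝ^d satisfy hypothesis (ii), let M > 0, set |b|_∞ := sup{|b(x,r)| : x ∈ ℝ^d, r ∈ ℝ} and b_M := sup{|∂_r b(x,r)| : x ∈ ℝ^d, |r| ≤ M}, and let b*(x,r) := b(x,r)r. Let u₁, u₂ ∈ L²(ℝ^d) ∩ L^∞(ℝ^d) with ‖u₁‖_∞ ≤ M and ‖u₂‖_∞ ≤ M, set u := u₁ − u₂ and F(x) := b*(x,u₁(x)) − b*(x,u₂(x)) (so F ∈ L²(ℝ^d;ℝ^d)). Then |⟨div F, u⟩_{-1}| ≤ 2(|b|_∞ + b_M‖u₁‖_∞) ‖u‖_{L²}^{3/2} ‖u‖_{H^{-2}}^{1/2}, where ⟨div F, u⟩_{-1} := ∫_{ℝ^d} (1 + 4π²‖ξ‖²)^{-1} (2πi ξ · 𝓕F(ξ)) \overline{𝓕u(ξ)} dξ. -/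

import Mathlib

open MeasureTheory Real Set ComplexConjugate

noncomputable section

/-- The Fourier transform `𝓕g(ξ) = ∫ e^{-2πi⟨x,ξ⟩} g(x) dx` of a real-valued function
on `ℝ^d`. -/
noncomputable def FT {d : ℕ} (g : EuclideanSpace ℝ (Fin d) → ℝ) :
    EuclideanSpace ℝ (Fin d) → ℂ :=
  FourierTransform.fourier (fun x => (g x : ℂ))

/-- Hypothesis (ii) on the drift `b : ℝ^d × ℝ → ℝ^d`: `b` is `C¹`, bounded, `b(x,0) = 0`,
`∂_r b` is bounded on `ℝ^d × [-M,M]` for every `M > 0`, and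
`δ(r) = sup_x |∇_x b(x,r)|` is a bounded continuous function of `r`. -/
def HypB {d : ℕ} (b : EuclideanSpace ℝ (Fin d) → ℝ → EuclideanSpace ℝ (Fin d)) : Prop :=
  ContDiff ℝ 1 (fun p : EuclideanSpace ℝ (Fin d) × ℝ => b p.1 p.2) ∧
  (∃ C, ∀ x r, ‖b x r‖ ≤ C) ∧
  (∀ x, b x 0 = 0) ∧
  (∀ M > (0 : ℝ), ∃ C, ∀ x r, |r| ≤ M → ‖deriv (fun s => b x s) r‖ ≤ C) ∧
  (∃ δb : ℝ → ℝ, Continuous δb ∧ (∃ C, ∀ r, δb r ≤ C) ∧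
    ∀ r, IsLUB (range fun x => ‖fderiv ℝ (fun y => b y r) x‖) (δb r))

section Plancherel

open FourierTransform SchwartzMap
open scoped ContDiff

variable {V : Type*} [NormedAddCommGroup V] [InnerProductSpace ℝ V] [FiniteDimensional ℝ V]
  [MeasurableSpace V] [BorelSpace V]

/-- On `L¹ ∩ L²` the `L²` Fourier transform agrees with the Fourier integral. -/
theorem Lp_fourier_toLp_ae_eq {f : V → ℂ} (hf : Integrable f) (hf2 : MemLp f 2) :
    ∀ᵐ ξ, (𝓕 (hf2.toLp f) : Lp ℂ 2 (volume : Measure V)) ξ = 𝓕 f ξ := by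
  have hcont : Continuous (𝓕 f) :=
    VectorFourier.fourierIntegral_continuous Real.continuous_fourierChar
      (innerSL ℝ).continuous₂ hf
  refine ae_eq_of_integral_contDiff_smul_eq
    ((Lp.memLp _).locallyIntegrable one_le_two) hcont.locallyIntegrable ?_
  intro g hg hgc
  have hg₁ : HasCompactSupport (Complex.ofRealCLM ∘ g) := hgc.comp_left rfl
  have hg₂ : ContDiff ℝ ∞ (Complex.ofRealCLM ∘ g) := by fun_prop
  set φ : 𝓢(V, ℂ) := hg₁.toSchwartzMap hg₂ with hφ
  have hφg : ∀ x, φ x = (g x : ℂ) := fun x => by simp [hφ]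
  calc ∫ x, g x • (𝓕 (hf2.toLp f) : Lp ℂ 2 (volume : Measure V)) x
      = Lp.toTemperedDistribution (𝓕 (hf2.toLp f)) φ := by
        rw [Lp.toTemperedDistribution_apply]
        simp [hφg]
    _ = Lp.toTemperedDistribution (hf2.toLp f) (𝓕 φ) := by
        rw [← Lp.fourier_toTemperedDistribution_eq, TemperedDistribution.fourier_apply]
    _ = ∫ x, (𝓕 (φ : V → ℂ)) x • f x := by
        rw [Lp.toTemperedDistribution_apply]
        refine integral_congr_ae ?_
        filter_upwards [hf2.coeFn_toLp] with x hx
        rw [hx, SchwartzMap.fourier_coe]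
    _ = ∫ x, φ x • 𝓕 f x := by
        have := VectorFourier.integral_fourierIntegral_smul_eq_flip (L := innerₗ V)
          Real.continuous_fourierChar (innerSL ℝ).continuous₂
          (φ.integrable (μ := volume)) hf
        rwa [flip_innerₗ] at this
    _ = ∫ x, g x • 𝓕 f x := by simp [hφg]

theorem memLp_two_fourier {f : V → ℂ} (hf : Integrable f) (hf2 : MemLp f 2) :
    MemLp (𝓕 f) 2 :=
  (memLp_congr_ae (Lp_fourier_toLp_ae_eq hf hf2)).mp (Lp.memLp _)

/-- Plancherel's identity on `L¹ ∩ L²`. -/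
theorem integral_norm_sq_fourier {f : V → ℂ} (hf : Integrable f) (hf2 : MemLp f 2) :
    ∫ ξ, ‖𝓕 f ξ‖ ^ 2 = ∫ x, ‖f x‖ ^ 2 := by
  have key (g : Lp ℂ 2 (volume : Measure V)) : ‖g‖ ^ 2 = ∫ x, ‖g x‖ ^ 2 := by
    rw [← inner_self_eq_norm_sq (𝕜 := ℂ) g, L2.inner_def]
    simp_rw [inner_self_eq_norm_sq_to_K]
    norm_cast
  have h := key (𝓕 (hf2.toLp f))
  rw [Lp.norm_fourier_eq, key] at h
  calc ∫ ξ, ‖𝓕 f ξ‖ ^ 2 = ∫ ξ, ‖(𝓕 (hf2.toLp f) : Lp ℂ 2 (volume : Measure V)) ξ‖ ^ 2 :=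
        integral_congr_ae ((Lp_fourier_toLp_ae_eq hf hf2).mono fun x hx => by simp only [hx])
    _ = ∫ x, ‖(hf2.toLp f) x‖ ^ 2 := h.symm
    _ = ∫ x, ‖f x‖ ^ 2 := integral_congr_ae (hf2.coeFn_toLp.mono fun x hx => by simp only [hx])

end Plancherel

/-- Cauchy–Schwarz for real functions, with squares as natural powers. -/
theorem integral_mul_le_rpow_mul_rpow {α : Type*} [MeasurableSpace α] {μ : Measure α}
    {f g : α → ℝ} (hf0 : ∀ x, 0 ≤ f x) (hg0 : ∀ x, 0 ≤ g x) (hf : MemLp f 2 μ)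
    (hg : MemLp g 2 μ) :
    ∫ x, f x * g x ∂μ ≤
      (∫ x, f x ^ 2 ∂μ) ^ ((1 : ℝ) / 2) * (∫ x, g x ^ 2 ∂μ) ^ ((1 : ℝ) / 2) := by
  have h := integral_mul_le_Lp_mul_Lq_of_nonneg (μ := μ) Real.HolderConjugate.two_two
    (Filter.Eventually.of_forall hf0) (Filter.Eventually.of_forall hg0)
    (by simpa using hf) (by simpa using hg)
  simpa only [Real.rpow_two] using h

/-- A weighted Cauchy–Schwarz inequality combined with interpolation between the weights `1`
and `w ^ 2`. -/
theorem integral_sqrt_weight_mul_le {α : Type*} [MeasurableSpace α] {μ : Measure α}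
    {f g w : α → ℝ} (hf0 : ∀ x, 0 ≤ f x) (hg0 : ∀ x, 0 ≤ g x) (hw0 : ∀ x, 0 ≤ w x)
    (hw1 : ∀ x, w x ≤ 1) (hf : MemLp f 2 μ) (hg : MemLp g 2 μ)
    (hw : AEStronglyMeasurable w μ) :
    ∫ x, f x * (√(w x) * g x) ∂μ ≤
      (∫ x, f x ^ 2 ∂μ) ^ ((1 : ℝ) / 2) *
        ((∫ x, g x ^ 2 ∂μ) ^ ((1 : ℝ) / 4) * (∫ x, w x ^ 2 * g x ^ 2 ∂μ) ^ ((1 : ℝ) / 4)) := by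
  have hsw : MemLp (fun x => √(w x) * g x) 2 μ := by
    refine hg.mono ((Real.continuous_sqrt.comp_aestronglyMeasurable hw).mul hg.1)
      (Filter.Eventually.of_forall fun x => ?_)
    rw [norm_mul, Real.norm_of_nonneg (Real.sqrt_nonneg _)]
    exact mul_le_of_le_one_left (norm_nonneg _) (Real.sqrt_le_one.mpr (hw1 x))
  have hwg : MemLp (fun x => w x * g x) 2 μ := by
    refine hg.mono (hw.mul hg.1) (Filter.Eventually.of_forall fun x => ?_)
    rw [norm_mul, Real.norm_of_nonneg (hw0 x)]
    exact mul_le_of_le_one_left (norm_nonneg _) (hw1 x)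
  have h₁ := integral_mul_le_rpow_mul_rpow hf0
    (fun x => mul_nonneg (Real.sqrt_nonneg (w x)) (hg0 x)) hf hsw
  have h₂ := integral_mul_le_rpow_mul_rpow hg0 (fun x => mul_nonneg (hw0 x) (hg0 x)) hg hwg
  have hsq : ∀ x, (√(w x) * g x) ^ 2 = g x * (w x * g x) := fun x => by
    rw [mul_pow, Real.sq_sqrt (hw0 x)]; ring
  simp only [hsq] at h₁
  simp only [mul_pow] at h₂
  have hA : 0 ≤ ∫ x, g x ^ 2 ∂μ := integral_nonneg fun x => sq_nonneg _
  have hB : 0 ≤ ∫ x, w x ^ 2 * g x ^ 2 ∂μ := integral_nonneg fun x => by positivity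
  refine h₁.trans (mul_le_mul_of_nonneg_left ?_ (Real.rpow_nonneg
    (integral_nonneg fun x => sq_nonneg _) _))
  calc (∫ x, g x * (w x * g x) ∂μ) ^ ((1 : ℝ) / 2)
      ≤ ((∫ x, g x ^ 2 ∂μ) ^ ((1 : ℝ) / 2) *
          (∫ x, w x ^ 2 * g x ^ 2 ∂μ) ^ ((1 : ℝ) / 2)) ^ ((1 : ℝ) / 2) :=
        Real.rpow_le_rpow (integral_nonneg fun x =>
          mul_nonneg (hg0 x) (mul_nonneg (hw0 x) (hg0 x))) h₂ (by norm_num)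
    _ = _ := by
        rw [Real.mul_rpow (by positivity) (by positivity), ← Real.rpow_mul hA,
          ← Real.rpow_mul hB]
        norm_num

/-- Pointwise bound for the Fourier symbol of `(I - Δ)⁻¹ div`. -/
theorem norm_symbol_mul_sum_le {d : ℕ} (ξ : EuclideanSpace ℝ (Fin d)) (a : Fin d → ℂ) (z : ℂ) :
    ‖((1 + 4 * π ^ 2 * ‖ξ‖ ^ 2 : ℝ) : ℂ)⁻¹ *
        ((2 * (π : ℂ) * Complex.I * ∑ j, (ξ j : ℂ) * a j) * conj z)‖ ≤
      √(∑ j, ‖a j‖ ^ 2) * (√((1 + 4 * π ^ 2 * ‖ξ‖ ^ 2)⁻¹) * ‖z‖) := by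
  have hsum : ‖∑ j, (ξ j : ℂ) * a j‖ ≤ ‖ξ‖ * √(∑ j, ‖a j‖ ^ 2) := by
    calc ‖∑ j, (ξ j : ℂ) * a j‖ ≤ ∑ j, ‖ξ j‖ * ‖a j‖ :=
          (norm_sum_le _ _).trans_eq (by simp)
      _ ≤ √(∑ j, ‖ξ j‖ ^ 2) * √(∑ j, ‖a j‖ ^ 2) := Real.sum_mul_le_sqrt_mul_sqrt _ _ _
      _ = _ := by rw [← EuclideanSpace.norm_eq]
  set D : ℝ := 1 + 4 * π ^ 2 * ‖ξ‖ ^ 2 with hD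
  have hD0 : 0 < D := by positivity
  have hπξ : 2 * π * ‖ξ‖ ≤ √D := Real.le_sqrt_of_sq_le (by rw [hD]; nlinarith)
  have hDinv : D⁻¹ * √D = √D⁻¹ := by
    rw [Real.sqrt_inv]
    nth_rewrite 1 [← Real.mul_self_sqrt hD0.le]
    have := (Real.sqrt_pos.mpr hD0).ne'
    field_simp
  have hnorm : ‖(D : ℂ)⁻¹ * ((2 * (π : ℂ) * Complex.I * ∑ j, (ξ j : ℂ) * a j) * conj z)‖ =
      D⁻¹ * (2 * π * ‖∑ j, (ξ j : ℂ) * a j‖ * ‖z‖) := by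
    simp [abs_of_pos hD0, abs_of_pos Real.pi_pos]
  rw [hnorm, ← hDinv]
  calc D⁻¹ * (2 * π * ‖∑ j, (ξ j : ℂ) * a j‖ * ‖z‖)
      ≤ D⁻¹ * (2 * π * (‖ξ‖ * √(∑ j, ‖a j‖ ^ 2)) * ‖z‖) := by gcongr
    _ = D⁻¹ * ((2 * π * ‖ξ‖) * √(∑ j, ‖a j‖ ^ 2) * ‖z‖) := by ring
    _ ≤ D⁻¹ * (√D * √(∑ j, ‖a j‖ ^ 2) * ‖z‖) := by gcongr
    _ = _ := by ring

/-- The pairing estimate in terms of the `L²` norms of the field and of the function. -/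
theorem norm_integral_div_pairing_le {d : ℕ}
    {F : EuclideanSpace ℝ (Fin d) → EuclideanSpace ℝ (Fin d)}
    {u : EuclideanSpace ℝ (Fin d) → ℝ} (hF : Integrable F) (hF2 : MemLp F 2)
    (hu : Integrable u) (hu2 : MemLp u 2) :
    ‖∫ ξ : EuclideanSpace ℝ (Fin d),
        ((1 + 4 * π ^ 2 * ‖ξ‖ ^ 2 : ℝ) : ℂ)⁻¹ *
          ((2 * (π : ℂ) * Complex.I * ∑ j, (ξ j : ℂ) * FT (fun x => F x j) ξ) *
            conj (FT u ξ))‖ ≤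
      (∫ x, ‖F x‖ ^ 2) ^ ((1 : ℝ) / 2) * ((∫ x, u x ^ 2) ^ ((1 : ℝ) / 4) *
        (∫ ξ : EuclideanSpace ℝ (Fin d),
          ((1 + 4 * π ^ 2 * ‖ξ‖ ^ 2)⁻¹) ^ 2 * ‖FT u ξ‖ ^ 2) ^ ((1 : ℝ) / 4)) := by
  have hFj (j : Fin d) : Integrable (fun x => ((F x j : ℝ) : ℂ)) :=
    ((EuclideanSpace.proj j : _ →L[ℝ] ℝ).integrable_comp hF).ofReal
  have hFj2 (j : Fin d) : MemLp (fun x => ((F x j : ℝ) : ℂ)) 2 :=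
    ((EuclideanSpace.proj j : _ →L[ℝ] ℝ).comp_memLp' hF2).ofReal
  have hFTu : MemLp (FT u) 2 := memLp_two_fourier hu.ofReal hu2.ofReal
  have hFTF (j : Fin d) : MemLp (FT fun x => F x j) 2 := memLp_two_fourier (hFj j) (hFj2 j)
  have hFTF_int (j : Fin d) : Integrable fun ξ => ‖FT (fun x => F x j) ξ‖ ^ 2 :=
    (memLp_two_iff_integrable_sq_norm (hFTF j).1).mp (hFTF j)
  have hG : MemLp (fun ξ => √(∑ j, ‖FT (fun x => F x j) ξ‖ ^ 2)) 2 := by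
    have hint : Integrable fun ξ => ∑ j, ‖FT (fun x => F x j) ξ‖ ^ 2 :=
      integrable_finsetSum _ fun j _ => hFTF_int j
    refine (memLp_two_iff_integrable_sq
      (Real.continuous_sqrt.comp_aestronglyMeasurable hint.1)).mpr (hint.congr ?_)
    exact Filter.Eventually.of_forall fun ξ => (Real.sq_sqrt (by positivity)).symm
  have hGint : ∫ ξ, √(∑ j, ‖FT (fun x => F x j) ξ‖ ^ 2) ^ 2 = ∫ x, ‖F x‖ ^ 2 := by
    calc ∫ ξ, √(∑ j, ‖FT (fun x => F x j) ξ‖ ^ 2) ^ 2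
        = ∫ ξ, ∑ j, ‖FT (fun x => F x j) ξ‖ ^ 2 :=
          integral_congr_ae (Filter.Eventually.of_forall fun ξ => Real.sq_sqrt (by positivity))
      _ = ∑ j, ∫ x, ‖((F x j : ℝ) : ℂ)‖ ^ 2 := by
          rw [integral_finsetSum _ fun j _ => hFTF_int j]
          exact Finset.sum_congr rfl fun j _ => integral_norm_sq_fourier (hFj j) (hFj2 j)
      _ = ∫ x, ∑ j, ‖((F x j : ℝ) : ℂ)‖ ^ 2 :=
          (integral_finsetSum _ fun j _ =>
            (memLp_two_iff_integrable_sq_norm (hFj2 j).1).mp (hFj2 j)).symm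
      _ = ∫ x, ‖F x‖ ^ 2 := by simp [EuclideanSpace.norm_sq_eq]
  have huint : ∫ ξ, ‖FT u ξ‖ ^ 2 = ∫ x, u x ^ 2 :=
    (integral_norm_sq_fourier hu.ofReal hu2.ofReal).trans (by simp)
  have hw : Continuous fun ξ : EuclideanSpace ℝ (Fin d) => (1 + 4 * π ^ 2 * ‖ξ‖ ^ 2)⁻¹ :=
    Continuous.inv₀ (by fun_prop) fun ξ => by positivity
  have hwle (ξ : EuclideanSpace ℝ (Fin d)) : (1 + 4 * π ^ 2 * ‖ξ‖ ^ 2)⁻¹ ≤ 1 :=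
    inv_le_one_of_one_le₀ (le_add_of_nonneg_right (by positivity))
  have hmain := integral_sqrt_weight_mul_le (μ := volume) (fun ξ => Real.sqrt_nonneg _)
    (fun ξ => norm_nonneg (FT u ξ)) (fun ξ => by positivity) hwle hG hFTu.norm
    hw.aestronglyMeasurable
  rw [hGint, huint] at hmain
  refine le_trans (norm_integral_le_of_norm_le ?_ (Filter.Eventually.of_forall fun ξ =>
    norm_symbol_mul_sum_le ξ (fun j => FT (fun x => F x j) ξ) (FT u ξ))) hmain
  refine hG.integrable_mul (hFTu.norm.mono ?_ (Filter.Eventually.of_forall fun ξ => ?_))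
  · exact (Real.continuous_sqrt.comp hw).aestronglyMeasurable.mul hFTu.norm.1
  · rw [norm_mul, Real.norm_of_nonneg (Real.sqrt_nonneg _)]
    exact mul_le_of_le_one_left (norm_nonneg _) (Real.sqrt_le_one.mpr (hwle ξ))

/-- Local Lipschitz estimate for `r ↦ r • b r` where `b` is bounded by `B` and has derivative
bounded by `K` on `[-M, M]`. -/
theorem norm_smul_sub_smul_le {E : Type*} [NormedAddCommGroup E] [NormedSpace ℝ E] {b : ℝ → E}
    {B K M : ℝ} (hb : Differentiable ℝ b) (hB : ∀ r, ‖b r‖ ≤ B)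
    (hK : ∀ r, |r| ≤ M → ‖deriv b r‖ ≤ K) {r s : ℝ} (hr : |r| ≤ M) (hs : |s| ≤ M) :
    ‖r • b r - s • b s‖ ≤ (B + K * |r|) * |r - s| := by
  have hmv : ‖b r - b s‖ ≤ K * ‖r - s‖ :=
    (convex_Icc (-M) M).norm_image_sub_le_of_norm_deriv_le (fun x _ => hb x)
      (fun x hx => hK x (abs_le.mpr hx)) (abs_le.mp hs) (abs_le.mp hr)
  rw [Real.norm_eq_abs] at hmv
  calc ‖r • b r - s • b s‖ = ‖r • (b r - b s) + (r - s) • b s‖ := by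
        congr 1; rw [smul_sub, sub_smul]; abel
    _ ≤ |r| * ‖b r - b s‖ + |r - s| * ‖b s‖ := by
        refine (norm_add_le _ _).trans_eq ?_
        rw [norm_smul, norm_smul, Real.norm_eq_abs, Real.norm_eq_abs]
    _ ≤ |r| * (K * |r - s|) + |r - s| * B := by gcongr; exact hB s
    _ = _ := by ring

/-- with `b` satisfying hypothesis (ii), `b*(x,r) = b(x,r)r`,
`u₁, u₂ ∈ L² ∩ L^∞` bounded by `M`, `u = u₁ − u₂`, and
`F(x) = b*(x,u₁(x)) − b*(x,u₂(x))`, one has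
`|⟨div F, u⟩_{-1}| ≤ 2(|b|_∞ + b_M ‖u₁‖_∞) ‖u‖_{L²}^{3/2} ‖u‖_{H^{-2}}^{1/2}`, where
`⟨div F, u⟩_{-1} = ∫ (1+4π²‖ξ‖²)^{-1} (2πi ξ·𝓕F(ξ)) conj(𝓕u(ξ)) dξ`. -/
theorem div_bstar_difference_H_neg_one_pairing_bound
    {d : ℕ} (b : EuclideanSpace ℝ (Fin d) → ℝ → EuclideanSpace ℝ (Fin d)) (hb : HypB b)
    (M : ℝ) (hM : 0 < M)
    (u₁ u₂ : EuclideanSpace ℝ (Fin d) → ℝ)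
    (hu₁ : MemLp u₁ 2 (volume : Measure (EuclideanSpace ℝ (Fin d))))
    (hu₂ : MemLp u₂ 2 (volume : Measure (EuclideanSpace ℝ (Fin d))))
    (hu₁M : ∀ᵐ x : EuclideanSpace ℝ (Fin d), |u₁ x| ≤ M)
    (hu₂M : ∀ᵐ x : EuclideanSpace ℝ (Fin d), |u₂ x| ≤ M)
    (F : EuclideanSpace ℝ (Fin d) → EuclideanSpace ℝ (Fin d))
    (hF : F = fun x => u₁ x • b x (u₁ x) - u₂ x • b x (u₂ x)) :
    ‖∫ ξ : EuclideanSpace ℝ (Fin d),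
        ((1 + 4 * π ^ 2 * ‖ξ‖ ^ 2 : ℝ) : ℂ)⁻¹ *
          ((2 * (π : ℂ) * Complex.I * ∑ j, (ξ j : ℂ) * FT (fun x => F x j) ξ) *
            conj (FT (fun x => u₁ x - u₂ x) ξ))‖
      ≤ 2 * (sSup (range fun p : EuclideanSpace ℝ (Fin d) × ℝ => ‖b p.1 p.2‖)
            + sSup {y : ℝ | ∃ x r, |r| ≤ M ∧ y = ‖deriv (fun s => b x s) r‖} *
              (eLpNorm u₁ ⊤ (volume : Measure (EuclideanSpace ℝ (Fin d)))).toReal) *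
        (∫ x : EuclideanSpace ℝ (Fin d), (u₁ x - u₂ x) ^ 2) ^ ((3 : ℝ) / 4) *
        (∫ ξ : EuclideanSpace ℝ (Fin d),
            ((1 + 4 * π ^ 2 * ‖ξ‖ ^ 2)⁻¹) ^ 2 *
              ‖FT (fun x => u₁ x - u₂ x) ξ‖ ^ 2) ^ ((1 : ℝ) / 4) := by
  obtain ⟨hbC, ⟨C, hC⟩, -, hbd, -⟩ := hb
  obtain ⟨C', hC'⟩ := hbd M hM
  set B := sSup (range fun p : EuclideanSpace ℝ (Fin d) × ℝ => ‖b p.1 p.2‖)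
  set K := sSup {y : ℝ | ∃ x r, |r| ≤ M ∧ y = ‖deriv (fun s => b x s) r‖}
  set m := (eLpNorm u₁ ⊤ (volume : Measure (EuclideanSpace ℝ (Fin d)))).toReal
  have hB (x r) : ‖b x r‖ ≤ B :=
    le_csSup ⟨C, by rintro _ ⟨p, rfl⟩; exact hC _ _⟩ ⟨(x, r), rfl⟩
  have hK (x r) (hr : |r| ≤ M) : ‖deriv (fun s => b x s) r‖ ≤ K :=
    le_csSup ⟨C', by rintro _ ⟨x, r, hr, rfl⟩; exact hC' _ _ hr⟩ ⟨x, r, hr, rfl⟩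
  have hB0 : 0 ≤ B := (norm_nonneg _).trans (hB 0 0)
  have hK0 : 0 ≤ K := (norm_nonneg _).trans (hK 0 0 (by simpa using hM.le))
  have hL0 : 0 ≤ B + K * m := add_nonneg hB0 (mul_nonneg hK0 ENNReal.toReal_nonneg)
  have hm : ∀ᵐ x, |u₁ x| ≤ m := by
    have htop : eLpNorm u₁ ⊤ (volume : Measure (EuclideanSpace ℝ (Fin d))) ≠ ⊤ :=
      (memLp_top_of_bound hu₁.1 M hu₁M).2.ne
    filter_upwards [ae_le_eLpNormEssSup (f := u₁)] with x hx
    rw [← eLpNorm_exponent_top] at hx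
    have h := ENNReal.toReal_mono htop hx
    rwa [toReal_enorm, Real.norm_eq_abs] at h
  by_cases hu : Integrable (fun x => u₁ x - u₂ x)
  swap
  · have h0 : FT (fun x => u₁ x - u₂ x) = 0 := by
      funext ξ
      refine integral_undef fun h => hu ?_
      have h' := (VectorFourier.fourierIntegral_convergent_iff Real.continuous_fourierChar
        (L := innerₗ (EuclideanSpace ℝ (Fin d))) (innerSL ℝ).continuous₂ ξ).mp h
      simpa using h'.re
    simp only [h0, Pi.zero_apply, map_zero, mul_zero, integral_zero, norm_zero]
    positivity
  have hu2 : MemLp (fun x => u₁ x - u₂ x) 2 := hu₁.sub hu₂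
  have hFle : ∀ᵐ x, ‖F x‖ ≤ (B + K * m) * |u₁ x - u₂ x| := by
    filter_upwards [hu₁M, hu₂M, hm] with x h₁ h₂ h₃
    rw [hF]
    refine (norm_smul_sub_smul_le ((hbC.comp (contDiff_prodMk_right x)).differentiable
      one_ne_zero) (hB x) (hK x) h₁ h₂).trans ?_
    gcongr
  have hFm : AEStronglyMeasurable F := by
    rw [hF]
    exact (hu₁.1.smul (hbC.continuous.comp_aestronglyMeasurable
      (aestronglyMeasurable_id.prodMk hu₁.1))).sub (hu₂.1.smul
        (hbC.continuous.comp_aestronglyMeasurable (aestronglyMeasurable_id.prodMk hu₂.1)))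
  have hFi : Integrable F := (hu.abs.const_mul (B + K * m)).mono' hFm hFle
  have hF2 : MemLp F 2 := hu2.of_le_mul hFm hFle
  have hU0 : 0 ≤ ∫ x, (u₁ x - u₂ x) ^ 2 := integral_nonneg fun x => sq_nonneg _
  have hFint : (∫ x, ‖F x‖ ^ 2) ^ ((1 : ℝ) / 2) ≤
      (B + K * m) * (∫ x, (u₁ x - u₂ x) ^ 2) ^ ((1 : ℝ) / 2) := by
    rw [← Real.sqrt_eq_rpow, ← Real.sqrt_eq_rpow]
    refine Real.sqrt_le_iff.mpr ⟨by positivity, ?_⟩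
    rw [mul_pow, Real.sq_sqrt hU0, ← integral_const_mul]
    refine integral_mono_ae ((memLp_two_iff_integrable_sq_norm hFm).mp hF2)
      (hu2.integrable_sq.const_mul _) ?_
    filter_upwards [hFle] with x hx
    calc ‖F x‖ ^ 2 ≤ ((B + K * m) * |u₁ x - u₂ x|) ^ 2 := by gcongr
      _ = _ := by rw [mul_pow, sq_abs]
  refine (norm_integral_div_pairing_le hFi hF2 hu hu2).trans ?_
  set U := ∫ x, (u₁ x - u₂ x) ^ 2
  set H := (∫ ξ : EuclideanSpace ℝ (Fin d), ((1 + 4 * π ^ 2 * ‖ξ‖ ^ 2)⁻¹) ^ 2 *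
    ‖FT (fun x => u₁ x - u₂ x) ξ‖ ^ 2) ^ ((1 : ℝ) / 4)
  have hH0 : 0 ≤ H := Real.rpow_nonneg (integral_nonneg fun ξ => by positivity) _
  have hpow : U ^ ((3 : ℝ) / 4) = U ^ ((1 : ℝ) / 2) * U ^ ((1 : ℝ) / 4) := by
    rw [← Real.rpow_add_of_nonneg hU0 (by norm_num) (by norm_num)]
    norm_num
  calc (∫ x, ‖F x‖ ^ 2) ^ ((1 : ℝ) / 2) * (U ^ ((1 : ℝ) / 4) * H)
      ≤ (B + K * m) * U ^ ((1 : ℝ) / 2) * (U ^ ((1 : ℝ) / 4) * H) := by gcongr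
    _ = (B + K * m) * U ^ ((3 : ℝ) / 4) * H := by rw [hpow]; ring
    _ ≤ 2 * (B + K * m) * U ^ ((3 : ℝ) / 4) * H := by gcongr; linarith

end
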